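/- Let σ be real with -1 < σ < 0. If (3-√3)/6 ≤ a ≤ 1/2 then the Hurwitz zeta value ζ(σ,a) is a positive real number, and if (3+√3)/6 ≤ a ≤ 1 then ζ(σ,a) is a negative real number. -/

import Mathlib

open HurwitzZeta

open Set Filter Topology MeasureTheory Asymptotics

theorem hasSum_exp_hurwitz (b t : ℝ) :
    HasSum (fun n : ℕ ↦ t ^ (n + 2) / (n + 2).factorial *
        (1 + (n + 2) * (b - 1 / 2) - (n + 2) * b ^ (n + 1)))
      ((Real.exp t - 1) * (1 + (b - 1 / 2) * t) - t * Real.exp (b * t)) := by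
  have hexp (x : ℝ) : HasSum (fun n : ℕ ↦ x ^ n / n.factorial) (Real.exp x) := by
    rw [Real.exp_eq_exp_ℝ]
    exact NormedSpace.expSeries_div_hasSum_exp x
  have h0 := (hasSum_nat_add_iff' 2).mpr (hexp t)
  have h1 := ((hasSum_nat_add_iff' 1).mpr (hexp t)).mul_left (t * (b - 1 / 2))
  have h2 := ((hasSum_nat_add_iff' 1).mpr (hexp (b * t))).mul_left t
  convert! (h0.add h1).sub h2 using 1
  · ext n
    have : ((n + 1).factorial : ℝ) ≠ 0 := by positivity
    rw [Nat.factorial_succ (n + 1)]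
    push_cast
    field_simp
    ring
  · simp [Finset.sum_range_succ]
    ring

theorem hurwitz_coeff_nonneg {b : ℝ} (hb : 1 / 2 ≤ b) (hb' : b ≤ 4 / 5)
    (hB : b ^ 2 - b + 1 / 6 ≤ 0) (n : ℕ) :
    0 ≤ 1 + (n + 2) * (b - 1 / 2) - (n + 2) * b ^ (n + 1) := by
  have key (m : ℕ) : b ^ (m + 2) ≤ 1 / (m + 3) + (b - 1 / 2) := by
    induction m with
    | zero => norm_num; linarith
    | succ m ih =>
      have h1 : b ^ (m + 1 + 2) ≤ b * (1 / (m + 3) + (b - 1 / 2)) := by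
        rw [pow_succ']; gcongr
      refine h1.trans ?_
      push_cast
      rcases Nat.eq_zero_or_pos m with rfl | hm
      · norm_num; nlinarith
      · have hm' : (1 : ℝ) ≤ m := by exact_mod_cast hm
        have h2 : b * (1 / ((m : ℝ) + 3)) ≤ 1 / (m + 1 + 3) := by
          rw [mul_one_div, div_le_div_iff₀ (by positivity) (by positivity)]
          nlinarith
        nlinarith
  rcases n with _ | n
  · norm_num; linarith
  · have h := key n
    push_cast
    have h3 : (n + 1 + 2 : ℝ) * b ^ (n + 1 + 1) ≤ (n + 1 + 2) * (1 / (n + 3) + (b - 1 / 2)) := by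
      gcongr
    have h4 : (n + 1 + 2 : ℝ) * (1 / (n + 3)) = 1 := by
      field_simp; ring
    linarith

theorem hurwitz_coeff_nonpos {b : ℝ} (hb : 0 ≤ b) (hb' : b ≤ 1 / 4)
    (hB : 0 ≤ b ^ 2 - b + 1 / 6) (n : ℕ) :
    1 + (n + 2) * (b - 1 / 2) - (n + 2) * b ^ (n + 1) ≤ 0 := by
  rcases n with _ | _ | n
  · norm_num; linarith
  · norm_num; linarith
  · have : 0 ≤ b ^ (n + 1 + 1 + 1) := by positivity
    push_cast
    nlinarith

theorem exp_hurwitz_pos {b t : ℝ} (hb : 1 / 2 ≤ b) (hb' : b < 4 / 5)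
    (hB : b ^ 2 - b + 1 / 6 ≤ 0) (ht : 0 < t) :
    0 < (Real.exp t - 1) * (1 + (b - 1 / 2) * t) - t * Real.exp (b * t) := by
  refine (hasSum_exp_hurwitz b t).tsum_eq ▸ (hasSum_exp_hurwitz b t).summable.tsum_pos
    (fun n ↦ mul_nonneg (by positivity) (hurwitz_coeff_nonneg hb hb'.le hB n)) 2
    (mul_pos (by positivity) ?_)
  norm_num
  nlinarith [mul_self_nonneg b, mul_self_nonneg (b - 1 / 2)]

theorem exp_hurwitz_neg {b t : ℝ} (hb : 0 ≤ b) (hb' : b < 1 / 4)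
    (hB : 0 ≤ b ^ 2 - b + 1 / 6) (ht : 0 < t) :
    (Real.exp t - 1) * (1 + (b - 1 / 2) * t) - t * Real.exp (b * t) < 0 := by
  have h := (hasSum_exp_hurwitz b t).neg
  refine neg_pos.mp (h.tsum_eq ▸ h.summable.tsum_pos (fun n ↦ ?_) 2 ?_)
  · exact neg_nonneg.mpr (mul_nonpos_of_nonneg_of_nonpos (by positivity)
      (hurwitz_coeff_nonpos hb hb'.le hB n))
  · refine neg_pos.mpr (mul_neg_of_pos_of_neg (by positivity) ?_)
    have : 0 ≤ b ^ 3 := by positivity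
    norm_num
    linarith

/-- The function whose Mellin transform is `Γ(s) ζ(s, a)` for `1 < re s`. -/
noncomputable def hurwitzKernel (a t : ℝ) : ℝ := Real.exp (-a * t) / (1 - Real.exp (-t))

/-- `hurwitzKernel` with the principal part and constant term at the origin removed. -/
noncomputable def hurwitzKernelSub (a t : ℝ) : ℝ := hurwitzKernel a t - (t⁻¹ + (1 / 2 - a))

theorem one_sub_exp_neg_pos {t : ℝ} (ht : 0 < t) : 0 < 1 - Real.exp (-t) := by
  simpa using ht

theorem continuousOn_hurwitzKernel (a : ℝ) : ContinuousOn (hurwitzKernel a) (Ioi 0) := by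
  unfold hurwitzKernel
  exact ContinuousOn.div (by fun_prop) (by fun_prop) fun t ht ↦ (one_sub_exp_neg_pos ht).ne'

theorem continuousOn_hurwitzKernelSub (a : ℝ) : ContinuousOn (hurwitzKernelSub a) (Ioi 0) := by
  unfold hurwitzKernelSub
  exact (continuousOn_hurwitzKernel a).sub
    ((continuousOn_inv₀.mono fun t ht ↦ ne_of_gt ht).add continuousOn_const)

theorem hurwitzKernelSub_eq (a : ℝ) {t : ℝ} (ht : 0 < t) :
    hurwitzKernelSub a t = -((Real.exp t - 1) * (1 + ((1 - a) - 1 / 2) * t) -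
      t * Real.exp ((1 - a) * t)) / (t * (Real.exp t - 1)) := by
  have h1 : Real.exp t - 1 ≠ 0 := by simpa [sub_eq_zero] using ht.ne'
  have h2 : Real.exp ((1 - a) * t) = Real.exp t * Real.exp (-a * t) := by
    rw [← Real.exp_add]; ring_nf
  have h3 := (one_sub_exp_neg_pos ht).ne'
  rw [Real.exp_neg] at h3
  have h4 := (Real.exp_pos t).ne'
  rw [hurwitzKernelSub, hurwitzKernel, h2, Real.exp_neg t]
  have h5 : 1 - (Real.exp t)⁻¹ = (Real.exp t - 1) / Real.exp t := by field_simp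
  rw [h5]
  field_simp
  ring

theorem hurwitzKernelSub_isBigO_zero (a : ℝ) :
    hurwitzKernelSub a =O[𝓝[>] 0] fun t ↦ t ^ (-(-1) : ℝ) := by
  have hexp : (fun t : ℝ ↦ Real.exp t - (1 + t + t ^ 2 / 2)) =O[𝓝 0] (· ^ 3) := by
    simpa [Finset.sum_range_succ] using Real.exp_sub_sum_range_isBigO_pow 3
  have hexp' : (fun t : ℝ ↦ Real.exp t - (1 + t)) =O[𝓝 0] (· ^ 2) := by
    simpa [Finset.sum_range_succ] using Real.exp_sub_sum_range_isBigO_pow 2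
  have hb : (fun t : ℝ ↦ Real.exp ((1 - a) * t) - (1 + (1 - a) * t)) =O[𝓝 0] (· ^ 2) := by
    have ht : Tendsto (fun t : ℝ ↦ (1 - a) * t) (𝓝 0) (𝓝 0) :=
      Continuous.tendsto' (by fun_prop) _ _ (by simp)
    refine (hexp'.comp_tendsto ht).trans ?_
    simpa [Function.comp_def, mul_pow] using
      (isBigO_refl (fun t : ℝ ↦ t ^ 2) (𝓝 0)).const_mul_left ((1 - a) ^ 2)
  have h1 : (fun t : ℝ ↦ t * (Real.exp ((1 - a) * t) - (1 + (1 - a) * t))) =O[𝓝 0] (· ^ 3) :=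
    ((isBigO_refl (fun t : ℝ ↦ t) (𝓝 0)).mul hb).congr_right fun t ↦ by ring
  have h2 : (fun t : ℝ ↦ (Real.exp t - (1 + t + t ^ 2 / 2)) * (1 + ((1 - a) - 1 / 2) * t))
      =O[𝓝 0] (· ^ 3) := by
    have hc : (fun t : ℝ ↦ 1 + ((1 - a) - 1 / 2) * t) =O[𝓝 0] fun _ ↦ (1 : ℝ) :=
      (Continuous.tendsto (by fun_prop) 0).isBigO_one ℝ
    exact (hexp.mul hc).congr_right fun t ↦ by ring
  have h3 : (fun t : ℝ ↦ ((1 - a) - 1 / 2) / 2 * t ^ 3) =O[𝓝 0] (· ^ 3) :=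
    (isBigO_refl _ _).const_mul_left _
  have hN := ((h1.sub h2).sub h3).mono (nhdsWithin_le_nhds (s := Ioi 0))
  have hD : (fun t : ℝ ↦ (t * (Real.exp t - 1))⁻¹) =O[𝓝[>] 0] fun t ↦ (t ^ 2)⁻¹ := by
    refine IsBigO.of_bound 1 ?_
    filter_upwards [self_mem_nhdsWithin] with t (ht : 0 < t)
    have : t ≤ Real.exp t - 1 := by linarith [Real.add_one_le_exp t]
    have h' : 0 < Real.exp t - 1 := ht.trans_le this
    rw [Real.norm_of_nonneg (by positivity), Real.norm_of_nonneg (by positivity), one_mul]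
    gcongr
    nlinarith
  refine (hN.mul hD).congr' ?_ ?_
  · filter_upwards [self_mem_nhdsWithin] with t ht
    rw [hurwitzKernelSub_eq a ht, div_eq_mul_inv]
    ring
  · filter_upwards [self_mem_nhdsWithin] with t (ht : 0 < t)
    simp only [neg_neg, Real.rpow_one]
    field_simp

theorem hurwitzKernel_isBigO_atTop (a : ℝ) :
    hurwitzKernel a =O[atTop] fun t ↦ Real.exp (-a * t) := by
  have : Tendsto (fun t : ℝ ↦ (1 - Real.exp (-t))⁻¹) atTop (𝓝 (1 - 0)⁻¹) :=
    (tendsto_const_nhds.sub Real.tendsto_exp_neg_atTop_nhds_zero).inv₀ (by simp)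
  exact ((isBigO_refl (fun t : ℝ ↦ Real.exp (-a * t)) atTop).mul (this.isBigO_one ℝ)).congr
    (fun t ↦ (div_eq_mul_inv _ _).symm) fun t ↦ mul_one _

theorem hurwitzKernelSub_isBigO_atTop {a : ℝ} (ha : 0 < a) :
    hurwitzKernelSub a =O[atTop] fun t ↦ t ^ (-0 : ℝ) := by
  simp only [neg_zero, Real.rpow_zero]
  have h1 : Tendsto (fun t : ℝ ↦ t⁻¹ + (1 / 2 - a)) atTop (𝓝 (0 + (1 / 2 - a))) :=
    tendsto_inv_atTop_zero.add tendsto_const_nhds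
  have h2 := (hurwitzKernel_isBigO_atTop a).trans (isLittleO_exp_neg_mul_rpow_atTop ha 0).isBigO
  simp only [Real.rpow_zero] at h2
  exact h2.sub (h1.isBigO_one ℝ)

/-- Mellin transform of a power of `t` on `(1, ∞)`. -/
theorem hasMellin_cpow_Ioi (a : ℂ) {s : ℂ} (hs : s.re + a.re < 0) :
    HasMellin (indicator (Ioi 1) (fun t => ↑t ^ a : ℝ → ℂ)) s (-1 / (s + a)) := by
  have h : (s - 1 + a).re < -1 := by simp; linarith
  have hEq : EqOn (fun t : ℝ ↦ (t : ℂ) ^ (s - 1) * (t : ℂ) ^ a) (fun t : ℝ ↦ (t : ℂ) ^ (s - 1 + a))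
      (Ioi 1) := fun t ht ↦
    (Complex.cpow_add _ _ (by exact_mod_cast (zero_lt_one.trans (mem_Ioi.mp ht)).ne')).symm
  have hsub : Ioi (1 : ℝ) ∩ Ioi 0 = Ioi 1 := inter_eq_left.mpr (Ioi_subset_Ioi zero_le_one)
  simp_rw [HasMellin, mellin, MellinConvergent, ← indicator_smul, IntegrableOn,
    integrable_indicator_iff measurableSet_Ioi, smul_eq_mul, integral_indicator measurableSet_Ioi,
    IntegrableOn, Measure.restrict_restrict measurableSet_Ioi, hsub]
  refine ⟨(integrableOn_congr_fun hEq measurableSet_Ioi).mpr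
    (integrableOn_Ioi_cpow_of_lt h one_pos), ?_⟩
  rw [setIntegral_congr_fun measurableSet_Ioi hEq, integral_Ioi_cpow_of_lt h one_pos]
  simp [show s - 1 + a + 1 = s + a by ring]

/-- The principal part `t⁻¹ + (1 / 2 - a)` of `hurwitzKernel` at the origin, truncated to `S`. -/
noncomputable def hurwitzPrincipalPart (a : ℝ) (S : Set ℝ) (t : ℝ) : ℂ :=
  indicator S (fun t ↦ ↑t ^ (-1 : ℂ) : ℝ → ℂ) t +
    (1 / 2 - a : ℂ) • indicator S (fun t ↦ ↑t ^ (0 : ℂ) : ℝ → ℂ) t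

theorem hurwitzPrincipalPart_of_mem (a : ℝ) {S : Set ℝ} {t : ℝ} (ht : t ∈ S) :
    hurwitzPrincipalPart a S t = ((t⁻¹ + (1 / 2 - a) : ℝ) : ℂ) := by
  simp [hurwitzPrincipalPart, ht, Complex.cpow_neg_one]

theorem hurwitzPrincipalPart_of_notMem (a : ℝ) {S : Set ℝ} {t : ℝ} (ht : t ∉ S) :
    hurwitzPrincipalPart a S t = 0 := by
  simp [hurwitzPrincipalPart, ht]

theorem hasMellin_hurwitzPrincipalPart_Ioc (a : ℝ) {s : ℂ} (hs : 1 < s.re) :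
    HasMellin (hurwitzPrincipalPart a (Ioc 0 1)) s (1 / (s - 1) + (1 / 2 - a) / s) := by
  have h1 := hasMellin_cpow_Ioc (-1) (s := s) (by simpa using hs)
  have h0 := hasMellin_cpow_Ioc 0 (s := s) (by simp; linarith)
  have h := hasMellin_add h1.1 (hasMellin_const_smul h0.1 (1 / 2 - a : ℂ)).1
  rw [h1.2, (hasMellin_const_smul h0.1 (1 / 2 - a : ℂ)).2, h0.2] at h
  convert! h using 1
  simp [div_eq_mul_inv, sub_eq_add_neg]

theorem hasMellin_hurwitzPrincipalPart_Ioi (a : ℝ) {s : ℂ} (hs : s.re < 0) :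
    HasMellin (hurwitzPrincipalPart a (Ioi 1)) s (-(1 / (s - 1) + (1 / 2 - a) / s)) := by
  have h1 := hasMellin_cpow_Ioi (-1) (s := s) (by simp; linarith)
  have h0 := hasMellin_cpow_Ioi 0 (s := s) (by simpa using hs)
  have h := hasMellin_add h1.1 (hasMellin_const_smul h0.1 (1 / 2 - a : ℂ)).1
  rw [h1.2, (hasMellin_const_smul h0.1 (1 / 2 - a : ℂ)).2, h0.2] at h
  convert! h using 1
  simp only [smul_eq_mul, add_zero]
  ring

theorem locallyIntegrableOn_hurwitzPrincipalPart (a : ℝ) {S : Set ℝ} (hS : MeasurableSet S) :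
    LocallyIntegrableOn (hurwitzPrincipalPart a S) (Ioi 0) := by
  have key (c : ℂ) : LocallyIntegrableOn (indicator S (fun t ↦ ↑t ^ c : ℝ → ℂ)) (Ioi 0) := by
    rw [locallyIntegrableOn_iff isOpen_Ioi.isLocallyClosed]
    intro K hK hKc
    refine IntegrableOn.indicator (ContinuousOn.integrableOn_compact hKc fun t ht ↦ ?_) hS
    exact (Complex.continuousAt_ofReal_cpow_const _ _
      (Or.inr (hK ht).ne')).continuousWithinAt
  exact (key (-1)).add ((key 0).smul (1 / 2 - a : ℂ))

/-- `hurwitzKernel` with its principal part removed near the origin only. -/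
noncomputable def hurwitzKernelTrunc (a t : ℝ) : ℂ :=
  hurwitzKernel a t - hurwitzPrincipalPart a (Ioc 0 1) t

theorem locallyIntegrableOn_hurwitzKernelTrunc (a : ℝ) :
    LocallyIntegrableOn (hurwitzKernelTrunc a) (Ioi 0) :=
  ((Complex.continuous_ofReal.comp_continuousOn
    (continuousOn_hurwitzKernel a)).locallyIntegrableOn measurableSet_Ioi).sub
    (locallyIntegrableOn_hurwitzPrincipalPart a measurableSet_Ioc)

theorem hurwitzKernelTrunc_isBigO_zero (a : ℝ) :
    hurwitzKernelTrunc a =O[𝓝[>] 0] fun t ↦ t ^ (-(-1) : ℝ) := by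
  refine (Complex.isBigO_ofReal_left.mpr (hurwitzKernelSub_isBigO_zero a)).congr' ?_ .rfl
  filter_upwards [Ioc_mem_nhdsGT one_pos] with t ht
  rw [hurwitzKernelTrunc, hurwitzPrincipalPart_of_mem a ht, hurwitzKernelSub, Complex.ofReal_sub]

theorem hurwitzKernelTrunc_isBigO_atTop (a : ℝ) :
    hurwitzKernelTrunc a =O[atTop] fun t ↦ Real.exp (-a * t) := by
  refine (Complex.isBigO_ofReal_left.mpr (hurwitzKernel_isBigO_atTop a)).congr' ?_ .rfl
  filter_upwards [eventually_gt_atTop 1] with t ht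
  rw [hurwitzKernelTrunc, hurwitzPrincipalPart_of_notMem a (fun h ↦ ht.not_ge h.2), sub_zero]

theorem mellin_hurwitzKernel {a : ℝ} (ha : 0 < a) (ha' : a ≤ 1) {s : ℂ} (hs : 1 < s.re) :
    mellin (fun t ↦ (hurwitzKernel a t : ℂ)) s = Complex.Gamma s * hurwitzZeta a s := by
  have hpos (n : ℕ) : 0 < n + a := by positivity
  have h := hasSum_mellin (a := fun _ : ℕ ↦ (1 : ℂ)) (p := fun n : ℕ ↦ n + a)
    (F := fun t ↦ (hurwitzKernel a t : ℂ)) (s := s) (fun n ↦ Or.inr (hpos n)) (by linarith)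
    (fun t (ht : 0 < t) ↦ ?_) ?_
  · refine h.unique ?_
    simpa [div_eq_mul_inv, mul_assoc] using
      (hasSum_hurwitzZeta_of_one_lt_re ⟨ha.le, ha'⟩ hs).mul_left (Complex.Gamma s)
  · have hg := (hasSum_geometric_of_lt_one (Real.exp_pos (-t)).le
      (by simpa using ht : Real.exp (-t) < 1)).mul_left (Real.exp (-a * t))
    have hg' := Complex.hasSum_ofReal.mpr hg
    convert! hg' using 1
    ext n
    rw [one_mul, ← Real.exp_nat_mul, ← Real.exp_add]
    ring_nf
  · refine ((Real.summable_one_div_nat_add_rpow a s.re).mpr hs).congr fun n ↦ ?_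
    rw [abs_of_pos (hpos n), norm_one]

theorem Gamma_mul_hurwitzZeta_eq_of_one_lt_re {a : ℝ} (ha : 0 < a) (ha' : a ≤ 1) {s : ℂ}
    (hs : 1 < s.re) :
    Complex.Gamma s * hurwitzZeta a s =
      mellin (hurwitzKernelTrunc a) s + (1 / (s - 1) + (1 / 2 - a) / s) := by
  have h1 := hasMellin_hurwitzPrincipalPart_Ioc a hs
  have h2 : MellinConvergent (hurwitzKernelTrunc a) s :=
    mellinConvergent_of_isBigO_rpow_exp ha (locallyIntegrableOn_hurwitzKernelTrunc a)
      (hurwitzKernelTrunc_isBigO_atTop a) (hurwitzKernelTrunc_isBigO_zero a) (by linarith)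
  rw [← mellin_hurwitzKernel ha ha' hs, ← h1.2, ← (hasMellin_add h2 h1.1).2]
  simp [hurwitzKernelTrunc]

theorem differentiableAt_Gamma_mul_hurwitzZeta (a : ℝ) {s : ℂ} (hs : -1 < s.re) (h0 : s ≠ 0)
    (h1 : s ≠ 1) :
    DifferentiableAt ℂ (fun s ↦ Complex.Gamma s * hurwitzZeta a s) s := by
  refine (Complex.differentiableAt_Gamma s fun m hm ↦ ?_).mul (differentiableAt_hurwitzZeta a h1)
  rcases m with _ | m
  · exact h0 (by simpa using hm)
  · have := congrArg Complex.re hm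
    simp at this
    have : (0 : ℝ) ≤ m := m.cast_nonneg
    linarith

theorem differentiableAt_mellin_hurwitzKernelTrunc {a : ℝ} (ha : 0 < a) {s : ℂ} (hs : -1 < s.re)
    (h0 : s ≠ 0) (h1 : s ≠ 1) :
    DifferentiableAt ℂ
      (fun s ↦ mellin (hurwitzKernelTrunc a) s + (1 / (s - 1) + (1 / 2 - a) / s)) s := by
  refine (mellin_differentiableAt_of_isBigO_rpow_exp ha (locallyIntegrableOn_hurwitzKernelTrunc a)
    (hurwitzKernelTrunc_isBigO_atTop a) (hurwitzKernelTrunc_isBigO_zero a) hs).add (.add ?_ ?_)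
  · exact (differentiableAt_const _).div (by fun_prop) (sub_ne_zero.mpr h1)
  · exact (differentiableAt_const _).div differentiableAt_id h0

/-- Analytic continuation of `Gamma_mul_hurwitzZeta_eq_of_one_lt_re` to `-1 < σ < 0`. -/
theorem Gamma_mul_hurwitzZeta_eq {a σ : ℝ} (ha : 0 < a) (ha' : a ≤ 1) (hσ : -1 < σ)
    (hσ' : σ < 0) :
    Complex.Gamma σ * hurwitzZeta a σ =
      mellin (hurwitzKernelTrunc a) σ + (1 / ((σ : ℂ) - 1) + (1 / 2 - a) / σ) := by
  let f : ℂ → ℂ := fun s ↦ Complex.Gamma s * hurwitzZeta a s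
  let g : ℂ → ℂ := fun s ↦ mellin (hurwitzKernelTrunc a) s + (1 / (s - 1) + (1 / 2 - a) / s)
  let U : Set ℂ := {s | -1 < s.re} ∩ {s | 0 < s.im}
  have hU : IsOpen U := (isOpen_lt continuous_const Complex.continuous_re).inter
    (isOpen_lt continuous_const Complex.continuous_im)
  have hUc : IsPreconnected U :=
    ((convex_halfSpace_re_gt _).inter (convex_halfSpace_im_gt _)).isPreconnected
  have hne {s : ℂ} (hs : s ∈ U) : s ≠ 0 ∧ s ≠ 1 := by
    constructor <;> rintro rfl <;> simpa using hs.2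
  have hfU : AnalyticOnNhd ℂ f U := DifferentiableOn.analyticOnNhd (fun s hs ↦
    (differentiableAt_Gamma_mul_hurwitzZeta a hs.1 (hne hs).1
      (hne hs).2).differentiableWithinAt) hU
  have hgU : AnalyticOnNhd ℂ g U := DifferentiableOn.analyticOnNhd (fun s hs ↦
    (differentiableAt_mellin_hurwitzKernelTrunc ha hs.1 (hne hs).1
      (hne hs).2).differentiableWithinAt) hU
  have hfg : EqOn f g U := by
    refine hfU.eqOn_of_preconnected_of_eventuallyEq hgU hUc
      (z₀ := 2 + Complex.I) ⟨by simp; norm_num, by simp⟩ ?_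
    filter_upwards [(isOpen_lt continuous_const Complex.continuous_re).mem_nhds
      (by simp : (1 : ℝ) < (2 + Complex.I).re)] with s hs
    exact Gamma_mul_hurwitzZeta_eq_of_one_lt_re ha ha' hs
  have h0 : (σ : ℂ) ≠ 0 := by exact_mod_cast hσ'.ne
  have h1 : (σ : ℂ) ≠ 1 := by exact_mod_cast (hσ'.trans one_pos).ne
  have hre : -1 < (σ : ℂ).re := by simpa using hσ
  have hlim : Tendsto (fun ε : ℝ ↦ (σ + ε * Complex.I : ℂ)) (𝓝[>] 0) (𝓝 σ) :=
    (Continuous.tendsto' (by fun_prop) _ _ (by simp)).mono_left nhdsWithin_le_nhds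
  refine tendsto_nhds_unique_of_eventuallyEq
    ((differentiableAt_Gamma_mul_hurwitzZeta a hre h0 h1).continuousAt.tendsto.comp hlim)
    ((differentiableAt_mellin_hurwitzKernelTrunc ha hre h0 h1).continuousAt.tendsto.comp hlim) ?_
  filter_upwards [self_mem_nhdsWithin] with ε (hε : 0 < ε)
  exact hfg ⟨by simpa using hσ, by simpa using hε⟩

theorem Gamma_mul_hurwitzZeta_eq_mellin {a σ : ℝ} (ha : 0 < a) (ha' : a ≤ 1) (hσ : -1 < σ)
    (hσ' : σ < 0) :
    Complex.Gamma σ * hurwitzZeta a σ = mellin (fun t ↦ (hurwitzKernelSub a t : ℂ)) σ := by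
  have h1 := hasMellin_hurwitzPrincipalPart_Ioi a (s := σ) (by simpa using hσ')
  have h2 : MellinConvergent (hurwitzKernelTrunc a) σ :=
    mellinConvergent_of_isBigO_rpow_exp ha (locallyIntegrableOn_hurwitzKernelTrunc a)
      (hurwitzKernelTrunc_isBigO_atTop a) (hurwitzKernelTrunc_isBigO_zero a) (by simpa using hσ)
  rw [Gamma_mul_hurwitzZeta_eq ha ha' hσ hσ', ← sub_neg_eq_add, ← h1.2, ← (hasMellin_sub h2 h1.1).2]
  refine setIntegral_congr_fun measurableSet_Ioi fun t (ht : 0 < t) ↦ ?_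
  simp only [hurwitzKernelTrunc, hurwitzKernelSub]
  rcases le_or_gt t 1 with h | h
  · rw [hurwitzPrincipalPart_of_mem a (show t ∈ Ioc 0 1 from ⟨ht, h⟩),
      hurwitzPrincipalPart_of_notMem a (show t ∉ Ioi 1 from not_lt.mpr h), sub_zero,
      Complex.ofReal_sub]
  · rw [hurwitzPrincipalPart_of_notMem a (show t ∉ Ioc 0 1 from fun h' ↦ h.not_ge h'.2),
      hurwitzPrincipalPart_of_mem a (show t ∈ Ioi 1 from h), sub_zero, Complex.ofReal_sub]

theorem hurwitzZeta_eq_ofReal {a σ : ℝ} (ha : 0 < a) (ha' : a ≤ 1) (hσ : -1 < σ)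
    (hσ' : σ < 0) :
    hurwitzZeta a σ =
      (((∫ t in Ioi 0, t ^ (σ - 1) * hurwitzKernelSub a t) / Real.Gamma σ : ℝ) : ℂ) := by
  have hΓ : Complex.Gamma σ ≠ 0 := by
    refine Complex.Gamma_ne_zero fun m hm ↦ ?_
    have hm' : σ = -m := by exact_mod_cast hm
    rcases m with _ | m
    · simp at hm'; linarith
    · push_cast at hm'
      linarith [(m.cast_nonneg : (0 : ℝ) ≤ m)]
  have h : mellin (fun t ↦ (hurwitzKernelSub a t : ℂ)) σ =
      ((∫ t in Ioi 0, t ^ (σ - 1) * hurwitzKernelSub a t : ℝ) : ℂ) := by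
    rw [mellin, ← integral_complex_ofReal]
    refine setIntegral_congr_fun measurableSet_Ioi fun t (ht : 0 < t) ↦ ?_
    simp [Complex.ofReal_cpow ht.le]
  rw [Complex.ofReal_div, ← h, ← Complex.Gamma_ofReal,
    ← Gamma_mul_hurwitzZeta_eq_mellin ha ha' hσ hσ', mul_div_cancel_left₀ _ hΓ]

theorem integrableOn_rpow_mul_hurwitzKernelSub {a σ : ℝ} (ha : 0 < a) (hσ : -1 < σ)
    (hσ' : σ < 0) :
    IntegrableOn (fun t ↦ t ^ (σ - 1) * hurwitzKernelSub a t) (Ioi 0) :=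
  mellin_convergent_of_isBigO_scalar
    ((continuousOn_hurwitzKernelSub a).locallyIntegrableOn measurableSet_Ioi)
    (hurwitzKernelSub_isBigO_atTop ha) hσ' (hurwitzKernelSub_isBigO_zero a) hσ

theorem setIntegral_Ioi_pos {f : ℝ → ℝ} (hf : IntegrableOn f (Ioi 0))
    (hpos : ∀ t, 0 < t → 0 < f t) : 0 < ∫ t in Ioi 0, f t := by
  rw [setIntegral_pos_iff_support_of_nonneg_ae
    ((ae_restrict_mem measurableSet_Ioi).mono fun t ht ↦ (hpos t ht).le) hf,
    show Function.support f ∩ Ioi 0 = Ioi 0 from inter_eq_right.mpr fun t ht ↦ (hpos t ht).ne']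
  simp

theorem Gamma_neg_of_mem_Ioo {σ : ℝ} (hσ : -1 < σ) (hσ' : σ < 0) : Real.Gamma σ < 0 := by
  have h := Real.Gamma_add_one hσ'.ne
  have h1 := Real.Gamma_pos_of_pos (by linarith : 0 < σ + 1)
  rw [h] at h1
  exact neg_of_mul_pos_right h1 hσ'.le

theorem hurwitzZeta_sign_on_neg_one_zero (a σ : ℝ) (hσ : -1 < σ) (hσ' : σ < 0) :
    (((3 - Real.sqrt 3) / 6 ≤ a → a ≤ 1 / 2 →
        (hurwitzZeta (a : UnitAddCircle) (σ : ℂ)).im = 0 ∧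
          0 < (hurwitzZeta (a : UnitAddCircle) (σ : ℂ)).re) ∧
      ((3 + Real.sqrt 3) / 6 ≤ a → a ≤ 1 →
        (hurwitzZeta (a : UnitAddCircle) (σ : ℂ)).im = 0 ∧
          (hurwitzZeta (a : UnitAddCircle) (σ : ℂ)).re < 0)) := by
  have h3 : Real.sqrt 3 ^ 2 = 3 := Real.sq_sqrt (by norm_num)
  have h3l : 3 / 2 < Real.sqrt 3 := Real.lt_sqrt_of_sq_lt (by norm_num)
  have h3u : Real.sqrt 3 < 9 / 5 := (Real.sqrt_lt' (by norm_num)).mpr (by norm_num)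
  have hΓ := Gamma_neg_of_mem_Ioo hσ hσ'
  refine ⟨fun hl hu ↦ ?_, fun hl hu ↦ ?_⟩
  · have ha : 0 < a := by linarith
    rw [hurwitzZeta_eq_ofReal ha (by linarith) hσ hσ', Complex.ofReal_im, Complex.ofReal_re]
    refine ⟨rfl, div_pos_of_neg_of_neg ?_ hΓ⟩
    rw [← neg_pos, ← integral_neg]
    refine setIntegral_Ioi_pos (integrableOn_rpow_mul_hurwitzKernelSub ha hσ hσ').neg fun t ht ↦ ?_
    have hexp : 0 < Real.exp t - 1 := by simpa using ht
    rw [hurwitzKernelSub_eq a ht, neg_div, mul_neg, neg_neg]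
    have := exp_hurwitz_pos (b := 1 - a) (by linarith) (by linarith) (by nlinarith) ht
    positivity
  · have ha : 0 < a := by linarith
    rw [hurwitzZeta_eq_ofReal ha hu hσ hσ', Complex.ofReal_im, Complex.ofReal_re]
    refine ⟨rfl, div_neg_of_pos_of_neg ?_ hΓ⟩
    refine setIntegral_Ioi_pos (integrableOn_rpow_mul_hurwitzKernelSub ha hσ hσ') fun t ht ↦ ?_
    have hexp : 0 < Real.exp t - 1 := by simpa using ht
    rw [hurwitzKernelSub_eq a ht]
    have := neg_pos.mpr (exp_hurwitz_neg (b := 1 - a) (by linarith) (by linarith) (by nlinarith) ht)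
    positivity
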